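/- Let d, n ≥ 1. The space of all linear operators M on (ℂ^d)^{⊗n} satisfying P_sym^{(d,n)} M P_sym^{(d,n)} = M (i.e., operators on the symmetric subspace) equals the complex linear span of {(|φ⟩⟨φ|)^{⊗n} : φ ∈ ℂ^d a unit vector}. -/

import Mathlib

open Matrix

noncomputable section

/-- The operator `P_d(π)` on `(ℂ^d)^{⊗n}` permuting tensor factors. -/
def permMat (d n : ℕ) (π : Equiv.Perm (Fin n)) :
    Matrix (Fin n → Fin d) (Fin n → Fin d) ℂ :=
  fun a b => if ∀ t, a t = b (π⁻¹ t) then 1 else 0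

/-- The symmetrizer `P_sym^{(d,n)} = (1/n!) ∑_{π ∈ S_n} P_d(π)`. -/
def psym (d n : ℕ) : Matrix (Fin n → Fin d) (Fin n → Fin d) ℂ :=
  (n.factorial : ℂ)⁻¹ • ∑ π : Equiv.Perm (Fin n), permMat d n π

/-- The tensor power `(|φ⟩⟨φ|)^{⊗n}` of the rank-one projector onto `φ`. -/
def outerPow (d n : ℕ) (φ : Fin d → ℂ) :
    Matrix (Fin n → Fin d) (Fin n → Fin d) ℂ :=
  fun a b => (∏ t, φ (a t)) * ∏ t, (starRingEnd ℂ) (φ (b t))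

open MvPolynomial in
/-- A polynomial in `z` and `w` that vanishes whenever `w` is the conjugate of `z` is zero. -/
theorem mvPolynomial_eq_zero_of_eval_conj {σ : Type*} [Finite σ] (p : MvPolynomial (σ ⊕ σ) ℂ)
    (h : ∀ φ : σ → ℂ, eval (Sum.elim φ fun i => (starRingEnd ℂ) (φ i)) p = 0) : p = 0 := by
  let g : σ ⊕ σ → MvPolynomial (σ ⊕ σ) ℂ :=
    Sum.elim (fun i => X (Sum.inl i) + C Complex.I * X (Sum.inr i))
      (fun i => X (Sum.inl i) - C Complex.I * X (Sum.inr i))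
  have hg (x : σ ⊕ σ → ℂ) : eval x (bind₁ g p) =
      eval (Sum.elim (fun i => x (Sum.inl i) + Complex.I * x (Sum.inr i))
        (fun i => x (Sum.inl i) - Complex.I * x (Sum.inr i))) p := by
    simp only [eval, eval₂Hom_bind₁]
    congr 2
    funext s
    cases s <;> simp [g]
  have hq : bind₁ g p = 0 := by
    refine funext_set (fun _ => Set.range ((↑) : ℝ → ℂ))
      (fun _ => Set.infinite_range_of_injective Complex.ofReal_injective) ?_
    intro x hx
    rw [map_zero, hg]
    choose y hy using fun s => hx s trivial
    convert h fun i => x (Sum.inl i) + Complex.I * x (Sum.inr i) using 4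
    simp only [← hy]
    simp [sub_eq_add_neg]
  refine MvPolynomial.funext fun x => ?_
  have := hg (Sum.elim (fun i => (x (Sum.inl i) + x (Sum.inr i)) / 2)
    (fun i => (x (Sum.inl i) - x (Sum.inr i)) / (2 * Complex.I)))
  rw [hq, map_zero] at this
  rw [map_zero, this]
  congr 2
  funext s
  have hI := Complex.I_ne_zero
  cases s <;> simp <;> field_simp <;> ring

/-- Two functions with the same number of occurrences of each value differ by a permutation. -/
theorem exists_perm_comp_eq_of_card_fiber {ι κ : Type*} [Fintype ι] [DecidableEq κ] {a b : ι → κ}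
    (h : ∀ i, Fintype.card {t // a t = i} = Fintype.card {t // b t = i}) :
    ∃ π : Equiv.Perm ι, b ∘ π = a := by
  let e := fun i => Fintype.equivOfCardEq (h i)
  refine ⟨(Equiv.sigmaFiberEquiv a).symm.trans
    ((Equiv.sigmaCongrRight e).trans (Equiv.sigmaFiberEquiv b)), ?_⟩
  funext t
  exact (e (a t) ⟨t, rfl⟩).2

theorem permMat_mul_apply {d n : ℕ} (π : Equiv.Perm (Fin n))
    (M : Matrix (Fin n → Fin d) (Fin n → Fin d) ℂ) (a b : Fin n → Fin d) :
    (permMat d n π * M) a b = M (a ∘ π) b := by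
  have h (c : Fin n → Fin d) : (∀ t, a t = c (π⁻¹ t)) ↔ a ∘ π = c := by
    constructor
    · intro h
      funext t
      simp [h]
    · rintro rfl t
      simp
  simp only [Matrix.mul_apply, permMat, h]
  simp

theorem mul_permMat_apply {d n : ℕ} (π : Equiv.Perm (Fin n))
    (M : Matrix (Fin n → Fin d) (Fin n → Fin d) ℂ) (a b : Fin n → Fin d) :
    (M * permMat d n π) a b = M a (b ∘ ⇑π⁻¹) := by
  have h (c : Fin n → Fin d) : (∀ t, c t = b (π⁻¹ t)) ↔ c = b ∘ ⇑π⁻¹ := by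
    simp [funext_iff]
  simp only [Matrix.mul_apply, permMat, h]
  simp

theorem permMat_mul_permMat {d n : ℕ} (π σ : Equiv.Perm (Fin n)) :
    permMat d n π * permMat d n σ = permMat d n (π * σ) := by
  ext a b
  rw [permMat_mul_apply]
  simp only [permMat, Function.comp_apply]
  congr 1
  rw [eq_iff_iff, ← π.forall_congr_right (q := fun t => a t = b ((π * σ)⁻¹ t))]
  simp

theorem permMat_mul_psym {d n : ℕ} (π : Equiv.Perm (Fin n)) :
    permMat d n π * psym d n = psym d n := by
  simp only [psym, Matrix.mul_smul, Finset.mul_sum, permMat_mul_permMat]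
  congr 1
  exact Equiv.sum_comp (Equiv.mulLeft π) fun σ => permMat d n σ

theorem psym_mul_permMat {d n : ℕ} (π : Equiv.Perm (Fin n)) :
    psym d n * permMat d n π = psym d n := by
  simp only [psym, Matrix.smul_mul, Finset.sum_mul, permMat_mul_permMat]
  congr 1
  exact Equiv.sum_comp (Equiv.mulRight π) fun σ => permMat d n σ

theorem psym_mul_eq_self {d n : ℕ} {M : Matrix (Fin n → Fin d) (Fin n → Fin d) ℂ}
    (h : ∀ π, permMat d n π * M = M) : psym d n * M = M := by
  simp only [psym, Matrix.smul_mul, Finset.sum_mul, h]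
  rw [Finset.sum_const, Finset.card_univ, Fintype.card_perm, Fintype.card_fin,
    ← Nat.cast_smul_eq_nsmul ℂ, smul_smul,
    inv_mul_cancel₀ (Nat.cast_ne_zero.2 n.factorial_ne_zero), one_smul]

theorem mul_psym_eq_self {d n : ℕ} {M : Matrix (Fin n → Fin d) (Fin n → Fin d) ℂ}
    (h : ∀ π, M * permMat d n π = M) : M * psym d n = M := by
  simp only [psym, Matrix.mul_smul, Finset.mul_sum, h]
  rw [Finset.sum_const, Finset.card_univ, Fintype.card_perm, Fintype.card_fin,
    ← Nat.cast_smul_eq_nsmul ℂ, smul_smul,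
    inv_mul_cancel₀ (Nat.cast_ne_zero.2 n.factorial_ne_zero), one_smul]

theorem psym_mul_outerPow_mul_psym (d n : ℕ) (φ : Fin d → ℂ) :
    psym d n * outerPow d n φ * psym d n = outerPow d n φ := by
  rw [psym_mul_eq_self, mul_psym_eq_self]
  · intro π
    ext a b
    rw [mul_permMat_apply]
    simp only [outerPow, Function.comp_apply]
    rw [Equiv.prod_comp π⁻¹ fun t => (starRingEnd ℂ) (φ (b t))]
  · intro π
    ext a b
    rw [permMat_mul_apply]
    simp only [outerPow, Function.comp_apply]
    rw [Equiv.prod_comp π fun t => φ (a t)]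

theorem apply_comp_perm_of_psym_mul_mul_psym {d n : ℕ}
    {M : Matrix (Fin n → Fin d) (Fin n → Fin d) ℂ} (hM : psym d n * M * psym d n = M)
    (π σ : Equiv.Perm (Fin n)) (a b : Fin n → Fin d) : M (a ∘ π) (b ∘ σ) = M a b := by
  have hl : permMat d n π * M = M := by
    rw [← hM, ← mul_assoc, ← mul_assoc, permMat_mul_psym]
  have hr : M * permMat d n σ⁻¹ = M := by
    rw [← hM, mul_assoc, psym_mul_permMat]
  calc M (a ∘ π) (b ∘ σ) = (permMat d n π * M) a (b ∘ σ) := (permMat_mul_apply π M a _).symm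
    _ = (M * permMat d n σ⁻¹) a b := by rw [hl, mul_permMat_apply, inv_inv]
    _ = M a b := by rw [hr]

/-- The exponent of the monomial `∏ t, z (a t) * ∏ t, w (b t)`. -/
def pairExponent (d n : ℕ) (x : (Fin n → Fin d) × (Fin n → Fin d)) : Fin d ⊕ Fin d →₀ ℕ :=
  ∑ t, Finsupp.single (Sum.inl (x.1 t)) 1 + ∑ t, Finsupp.single (Sum.inr (x.2 t)) 1

theorem pairExponent_inl (d n : ℕ) (x : (Fin n → Fin d) × (Fin n → Fin d)) (i : Fin d) :
    pairExponent d n x (Sum.inl i) = Fintype.card {t // x.1 t = i} := by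
  simp [pairExponent, Finsupp.single_apply, Fintype.card_subtype]

theorem pairExponent_inr (d n : ℕ) (x : (Fin n → Fin d) × (Fin n → Fin d)) (i : Fin d) :
    pairExponent d n x (Sum.inr i) = Fintype.card {t // x.2 t = i} := by
  simp [pairExponent, Finsupp.single_apply, Fintype.card_subtype]

theorem factorsThrough_pairExponent {d n : ℕ}
    {M : Matrix (Fin n → Fin d) (Fin n → Fin d) ℂ} (hM : psym d n * M * psym d n = M) :
    Function.FactorsThrough (fun x : (Fin n → Fin d) × (Fin n → Fin d) => M x.1 x.2)
      (pairExponent d n) := by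
  intro x y hxy
  obtain ⟨π, hπ⟩ := exists_perm_comp_eq_of_card_fiber (a := x.1) (b := y.1) fun i => by
    rw [← pairExponent_inl, ← pairExponent_inl, hxy]
  obtain ⟨σ, hσ⟩ := exists_perm_comp_eq_of_card_fiber (a := x.2) (b := y.2) fun i => by
    rw [← pairExponent_inr, ← pairExponent_inr, hxy]
  simp only [← hπ, ← hσ]
  exact apply_comp_perm_of_psym_mul_mul_psym hM π σ y.1 y.2

theorem eval_monomial_pairExponent (d n : ℕ) (x : (Fin n → Fin d) × (Fin n → Fin d)) (c : ℂ)
    (φ : Fin d → ℂ) :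
    MvPolynomial.eval (Sum.elim φ fun i => (starRingEnd ℂ) (φ i))
      (MvPolynomial.monomial (pairExponent d n x) c) = c * outerPow d n φ x.1 x.2 := by
  rw [← mul_one c, pairExponent, ← MvPolynomial.C_mul_monomial, ← one_mul (1 : ℂ),
    ← MvPolynomial.monomial_mul, MvPolynomial.monomial_sum_one, MvPolynomial.monomial_sum_one]
  simp [outerPow, MvPolynomial.eval_monomial]

/-- A linear functional that vanishes on all `(|φ⟩⟨φ|)^{⊗n}` vanishes on every operator on the
symmetric subspace. -/
theorem eq_zero_of_forall_outerPow {d n : ℕ}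
    (f : Matrix (Fin n → Fin d) (Fin n → Fin d) ℂ →ₗ[ℂ] ℂ) (hf : ∀ φ, f (outerPow d n φ) = 0)
    {M : Matrix (Fin n → Fin d) (Fin n → Fin d) ℂ} (hM : psym d n * M * psym d n = M) :
    f M = 0 := by
  have hsum (N : Matrix (Fin n → Fin d) (Fin n → Fin d) ℂ) :
      f N = ∑ x : (Fin n → Fin d) × (Fin n → Fin d), f (Matrix.single x.1 x.2 1) * N x.1 x.2 := by
    conv_lhs => rw [Matrix.matrix_eq_sum_single N]
    simp only [map_sum, Fintype.sum_prod_type]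
    refine Finset.sum_congr rfl fun a _ => Finset.sum_congr rfl fun b _ => ?_
    rw [mul_comm, ← smul_eq_mul, ← map_smul, Matrix.smul_single, smul_eq_mul, mul_one]
  have hp : ∑ x, MvPolynomial.monomial (pairExponent d n x) (f (Matrix.single x.1 x.2 1)) = 0 := by
    refine mvPolynomial_eq_zero_of_eval_conj _ fun φ => ?_
    simp only [map_sum, eval_monomial_pairExponent]
    rw [← hsum, hf]
  let g : (Fin d ⊕ Fin d →₀ ℕ) → ℂ :=
    Function.extend (pairExponent d n) (fun x => M x.1 x.2) 0
  rw [hsum]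
  let L : MvPolynomial (Fin d ⊕ Fin d) ℂ →ₗ[ℂ] ℂ :=
    (MvPolynomial.basisMonomials (Fin d ⊕ Fin d) ℂ).constr ℂ g
  have hLm (m c) : L (MvPolynomial.monomial m c) = c * g m := by
    rw [← mul_one c, ← smul_eq_mul, ← MvPolynomial.smul_monomial, map_smul, smul_eq_mul, smul_eq_mul,
      mul_one]
    congr 1
    exact (MvPolynomial.basisMonomials _ ℂ).constr_basis ℂ g m
  have hL := congrArg L hp
  rw [map_zero, map_sum] at hL
  rw [← hL]
  refine Finset.sum_congr rfl fun x _ => ?_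
  rw [hLm]
  congr 1
  exact ((factorsThrough_pairExponent hM).extend_apply 0 x).symm

/-- Every `(|φ⟩⟨φ|)^{⊗n}` is a multiple of one with `φ` a unit vector. -/
theorem outerPow_mem_span_unit {d n : ℕ} (hn : 1 ≤ n) (φ : Fin d → ℂ) :
    outerPow d n φ ∈ Submodule.span ℂ
      {M : Matrix (Fin n → Fin d) (Fin n → Fin d) ℂ |
        ∃ φ : Fin d → ℂ, (∑ i, ‖φ i‖ ^ 2 = 1) ∧ M = outerPow d n φ} := by
  have hsmul (c : ℂ) (ψ : Fin d → ℂ) :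
      outerPow d n (c • ψ) = (c ^ n * (starRingEnd ℂ) c ^ n) • outerPow d n ψ := by
    ext a b
    simp only [outerPow, Pi.smul_apply, smul_eq_mul, map_mul, Finset.prod_mul_distrib,
      Finset.prod_const, Finset.card_univ, Fintype.card_fin, Matrix.smul_apply]
    ring
  by_cases hφ : φ = 0
  · have := hsmul 0 φ
    rw [zero_smul, zero_pow (by omega), zero_mul, zero_smul] at this
    rw [hφ, this]
    exact zero_mem _
  · set s : ℝ := ∑ i, ‖φ i‖ ^ 2 with hs
    have hpos : 0 < s := by
      obtain ⟨i, hi⟩ := Function.ne_iff.1 hφ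
      exact Finset.sum_pos' (fun _ _ => by positivity)
        ⟨i, Finset.mem_univ i, pow_pos (norm_pos_iff.2 hi) 2⟩
    have hc : (Real.sqrt s : ℂ) ≠ 0 := Complex.ofReal_ne_zero.2 (Real.sqrt_pos.2 hpos).ne'
    rw [← smul_inv_smul₀ hc φ, hsmul]
    refine Submodule.smul_mem _ _ (Submodule.subset_span ⟨_, ?_, rfl⟩)
    simp only [Pi.smul_apply, norm_smul, mul_pow, ← Finset.mul_sum, ← hs]
    rw [norm_inv, Complex.norm_real, Real.norm_eq_abs, inv_pow, sq_abs, Real.sq_sqrt hpos.le,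
      inv_mul_cancel₀ hpos.ne']

/-- Operators on the symmetric subspace (i.e. `M` with `P_sym M P_sym = M`) are exactly
the complex linear span of `{(|φ⟩⟨φ|)^{⊗n} : φ a unit vector}`. -/
theorem operators_on_sym_subspace_eq_complex_span_of_tensor_power_projectors
    (d n : ℕ) (hd : 1 ≤ d) (hn : 1 ≤ n) :
    {M : Matrix (Fin n → Fin d) (Fin n → Fin d) ℂ | psym d n * M * psym d n = M} =
      ↑(Submodule.span ℂ
        {M : Matrix (Fin n → Fin d) (Fin n → Fin d) ℂ |
          ∃ φ : Fin d → ℂ, (∑ i, ‖φ i‖ ^ 2 = 1) ∧ M = outerPow d n φ}) := by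
  refine Set.Subset.antisymm (fun M hM => ?_) fun M hM => ?_
  · by_contra hmem
    obtain ⟨f, hfM, hf⟩ := Submodule.exists_le_ker_of_notMem hmem
    exact hfM (eq_zero_of_forall_outerPow f (fun φ => hf (outerPow_mem_span_unit hn φ)) hM)
  · change psym d n * M * psym d n = M
    induction hM using Submodule.span_induction with
    | mem N hN =>
      obtain ⟨φ, -, rfl⟩ := hN
      exact psym_mul_outerPow_mul_psym d n φ
    | zero => simp
    | add A B _ _ hA hB => rw [mul_add, add_mul, hA, hB]
    | smul c A _ hA => rw [Matrix.mul_smul, Matrix.smul_mul, hA]
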